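/- arXiv:1304.7012 — 2 statements merged into one kernel-verified Lean document; each statement's English description precedes it below -/
import Mathlib

section
/- For the cuspidal cubic x₁² + x₂³ = 0 in 𝔸², the reduced 5-th jet scheme at the origin is Spec k[X̲₁,…,X̲₅]/(X_{1,1}, X_{2,1}, X_{1,2}), which has dimension 7 > 5·1 + 1; consequently the cusp is not a top singularity. -/
/-!
STATEMENT 2: For the cuspidal cubic `x₁² + x₂³ = 0` in `𝔸²`, the reduced 5-th jet scheme at
the origin is `Spec k[X̲₁,…,X̲₅]/(X_{1,1}, X_{2,1}, X_{1,2})`, which has dimension `7 > 5·1+1`;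
consequently the cusp is not a top singularity (`dim Xₘ⁰ = m·1+1` fails for some `m ≥ 1`).
(Variable `(j,i) : Fin 2 × Fin m` stands for `X_{j+1,i+1}`.)
-/

open MvPolynomial

noncomputable def jetPoly (k : Type*) [CommRing k] (N m : ℕ)
    (f : MvPolynomial (Fin N) k) (n : ℕ) : MvPolynomial (Fin N × Fin m) k :=
  (Polynomial.coeff
    (MvPolynomial.aeval
      (fun j : Fin N =>
        ∑ i : Fin m,
          Polynomial.C (MvPolynomial.X (R := k) (j, i)) * Polynomial.X ^ ((i : ℕ) + 1)) f) n)

noncomputable def jetIdeal (k : Type*) [CommRing k] (N : ℕ)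
    (I : Ideal (MvPolynomial (Fin N) k)) (m : ℕ) :
    Ideal (MvPolynomial (Fin N × Fin m) k) :=
  Ideal.span {g | ∃ f ∈ I, ∃ n, 1 ≤ n ∧ n ≤ m ∧ g = jetPoly k N m f n}

/-- The ideal of the cusp `x₁² + x₂³ = 0` in `𝔸²`. -/
noncomputable def cuspIdeal (k : Type*) [CommRing k] : Ideal (MvPolynomial (Fin 2) k) :=
  Ideal.span {(X 0 ^ 2 + X 1 ^ 3 : MvPolynomial (Fin 2) k)}

/-- The ideal generated by a set of variables is the kernel of the map killing them. -/
theorem ker_killCompl_subtype_val {σ R : Type*} [CommRing R] (s : Set σ) :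
    RingHom.ker (killCompl (R := R) (Subtype.val_injective : Function.Injective
      (Subtype.val : {i // i ∉ s} → σ))) = Ideal.span (X '' s) := by
  apply le_antisymm
  · intro p hp
    have key : (Ideal.Quotient.mkₐ R (Ideal.span (X '' s : Set (MvPolynomial σ R)))).comp
        ((rename Subtype.val).comp (killCompl (Subtype.val_injective :
          Function.Injective (Subtype.val : {i // i ∉ s} → σ)))) =
        Ideal.Quotient.mkₐ R (Ideal.span (X '' s)) := by
      apply MvPolynomial.algHom_ext
      intro i
      by_cases hi : i ∈ s
      · have h0 : Ideal.Quotient.mk (Ideal.span (X '' s : Set (MvPolynomial σ R))) (X i) = 0 :=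
          Ideal.Quotient.eq_zero_iff_mem.mpr (Ideal.subset_span ⟨i, hi, rfl⟩)
        simp [killCompl, hi, h0]
      · have h1 : killCompl (R := R) (Subtype.val_injective :
            Function.Injective (Subtype.val : {i // i ∉ s} → σ)) (X i) = X ⟨i, hi⟩ := by
          rw [← killCompl_rename_app (R := R) (Subtype.val_injective :
            Function.Injective (Subtype.val : {i // i ∉ s} → σ)) (X ⟨i, hi⟩), rename_X]
        simp [h1]
    have h := DFunLike.congr_fun key p
    rw [RingHom.mem_ker] at hp
    simp only [AlgHom.comp_apply, hp, map_zero] at h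
    exact Ideal.Quotient.eq_zero_iff_mem.mp h.symm
  · rw [Ideal.span_le]
    rintro _ ⟨i, hi, rfl⟩
    simp [RingHom.mem_ker, killCompl, hi]

theorem isPrime_span_X_image {σ R : Type*} [CommRing R] [IsDomain R] (s : Set σ) :
    (Ideal.span (X '' s : Set (MvPolynomial σ R))).IsPrime := by
  rw [← ker_killCompl_subtype_val]
  exact RingHom.ker_isPrime _

theorem ringKrullDim_quotient_span_X_image {σ k : Type*} [Finite σ] [Field k] (s : Set σ) :
    ringKrullDim (MvPolynomial σ k ⧸ Ideal.span (X '' s : Set (MvPolynomial σ k))) =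
      Nat.card {i // i ∉ s} := by
  have hsurj : Function.Surjective (killCompl (R := k)
      (Subtype.val_injective : Function.Injective (Subtype.val : {i // i ∉ s} → σ))) :=
    fun p => ⟨rename Subtype.val p, killCompl_rename_app _ p⟩
  rw [← ker_killCompl_subtype_val, ringKrullDim_eq_of_ringEquiv
    (Ideal.quotientKerAlgEquivOfSurjective hsurj).toRingEquiv,
    MvPolynomial.ringKrullDim_of_isNoetherianRing, ringKrullDim_eq_zero_of_field, zero_add]

theorem ringKrullDim_quotient_radical {R : Type*} [CommRing R] (I : Ideal R) :
    ringKrullDim (R ⧸ I.radical) = ringKrullDim (R ⧸ I) := by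
  rw [ringKrullDim_quotient, ringKrullDim_quotient, PrimeSpectrum.zeroLocus_radical]

/-- The universal `5`-jet of the cusp polynomial, up to terms of order `5`. -/
theorem exists_aeval_cusp_eq {R : Type*} [CommRing R] (a b : Fin 5 → R) :
    ∃ q : Polynomial R,
      (∑ i : Fin 5, Polynomial.C (a i) * Polynomial.X ^ ((i : ℕ) + 1)) ^ 2 +
        (∑ i : Fin 5, Polynomial.C (b i) * Polynomial.X ^ ((i : ℕ) + 1)) ^ 3 =
      Polynomial.C (a 0 ^ 2) * Polynomial.X ^ 2 +
        Polynomial.C (2 * a 0 * a 1 + b 0 ^ 3) * Polynomial.X ^ 3 +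
        Polynomial.C (2 * a 0 * a 2 + a 1 ^ 2 + 3 * b 0 ^ 2 * b 1) * Polynomial.X ^ 4 +
        q * Polynomial.X ^ 5 := by
  obtain ⟨u, hu⟩ : ∃ u : Polynomial R,
      u = Polynomial.C (a 3) + Polynomial.C (a 4) * Polynomial.X := ⟨_, rfl⟩
  obtain ⟨v, hv⟩ : ∃ v : Polynomial R, v = Polynomial.C (b 2) +
      Polynomial.C (b 3) * Polynomial.X + Polynomial.C (b 4) * Polynomial.X ^ 2 := ⟨_, rfl⟩
  have hA : ∑ i : Fin 5, Polynomial.C (a i) * Polynomial.X ^ ((i : ℕ) + 1) =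
      Polynomial.C (a 0) * Polynomial.X + Polynomial.C (a 1) * Polynomial.X ^ 2 +
        Polynomial.C (a 2) * Polynomial.X ^ 3 + u * Polynomial.X ^ 4 := by
    simp [Fin.sum_univ_five, hu]; ring
  have hB : ∑ i : Fin 5, Polynomial.C (b i) * Polynomial.X ^ ((i : ℕ) + 1) =
      Polynomial.C (b 0) * Polynomial.X + Polynomial.C (b 1) * Polynomial.X ^ 2 +
        v * Polynomial.X ^ 3 := by
    simp [Fin.sum_univ_five, hv]; ring
  rw [hA, hB]
  set T : Polynomial R := Polynomial.X
  set A := fun i => Polynomial.C (a i)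
  set B := fun i => Polynomial.C (b i)
  refine ⟨2 * (A 0 * u + A 1 * A 2) + (2 * A 1 * u + A 2 ^ 2) * T + 2 * A 2 * u * T ^ 2 +
    u ^ 2 * T ^ 3 + 3 * B 0 * B 1 ^ 2 + B 1 ^ 3 * T + 3 * B 0 ^ 2 * v +
    6 * B 0 * B 1 * v * T + 3 * B 1 ^ 2 * v * T ^ 2 + 3 * B 0 * v ^ 2 * T ^ 2 +
    3 * B 1 * v ^ 2 * T ^ 3 + v ^ 3 * T ^ 4, ?_⟩
  simp only [map_add, map_mul, map_pow, map_ofNat, A, B]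
  ring

theorem coeff_aeval_cusp {R : Type*} [CommRing R] (a b : Fin 5 → R) (p : Polynomial R)
    (hp : p = (∑ i : Fin 5, Polynomial.C (a i) * Polynomial.X ^ ((i : ℕ) + 1)) ^ 2 +
        (∑ i : Fin 5, Polynomial.C (b i) * Polynomial.X ^ ((i : ℕ) + 1)) ^ 3) :
    p.coeff 2 = a 0 ^ 2 ∧ p.coeff 3 = 2 * a 0 * a 1 + b 0 ^ 3 ∧
      p.coeff 4 = 2 * a 0 * a 2 + a 1 ^ 2 + 3 * b 0 ^ 2 * b 1 := by
  obtain ⟨q, hq⟩ := exists_aeval_cusp_eq a b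
  rw [hp, hq]
  simp only [Polynomial.coeff_add, Polynomial.coeff_mul_X_pow', Polynomial.coeff_C]
  norm_num

theorem X_pow_six_dvd_aeval_cusp {R : Type*} [CommRing R] (a b : Fin 5 → R)
    (ha₀ : a 0 = 0) (ha₁ : a 1 = 0) (hb₀ : b 0 = 0) :
    Polynomial.X ^ 6 ∣ (∑ i : Fin 5, Polynomial.C (a i) * Polynomial.X ^ ((i : ℕ) + 1)) ^ 2 +
        (∑ i : Fin 5, Polynomial.C (b i) * Polynomial.X ^ ((i : ℕ) + 1)) ^ 3 := by
  simp only [Fin.sum_univ_five, ha₀, ha₁, hb₀, map_zero, zero_mul, zero_add]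
  refine dvd_add ?_ ?_
  · rw [show 6 = 3 * 2 from rfl, pow_mul]
    refine pow_dvd_pow_of_dvd (dvd_add (dvd_add ?_ ?_) ?_) 2 <;>
      exact dvd_mul_of_dvd_right (pow_dvd_pow _ (by decide)) _
  · rw [show 6 = 2 * 3 from rfl, pow_mul]
    refine pow_dvd_pow_of_dvd (dvd_add (dvd_add (dvd_add ?_ ?_) ?_) ?_) 3 <;>
      exact dvd_mul_of_dvd_right (pow_dvd_pow _ (by decide)) _

section Cusp

variable (k : Type*) [Field k]

theorem jetPoly_cusp_mem {n : ℕ} (h₁ : 1 ≤ n) (h₅ : n ≤ 5) :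
    jetPoly k 2 5 (X 0 ^ 2 + X 1 ^ 3) n ∈ jetIdeal k 2 (cuspIdeal k) 5 :=
  Ideal.subset_span ⟨_, Ideal.subset_span rfl, n, h₁, h₅, rfl⟩

/-- The variables `X_{1,1}`, `X_{2,1}`, `X_{1,2}`. -/
def cuspVars : Set (Fin 2 × Fin 5) := {(0, 0), (1, 0), (0, 1)}

theorem span_X_cuspVars_le_radical :
    Ideal.span (X '' cuspVars : Set (MvPolynomial (Fin 2 × Fin 5) k)) ≤
      (jetIdeal k 2 (cuspIdeal k) 5).radical := by
  obtain ⟨e2, e3, e4⟩ := coeff_aeval_cusp (fun i => X (R := k) ((0 : Fin 2), i))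
    (fun i => X (R := k) ((1 : Fin 2), i)) _ rfl
  have hjet (n : ℕ) (h₁ : 1 ≤ n) (h₅ : n ≤ 5) :=
    Ideal.le_radical (jetPoly_cusp_mem k h₁ h₅)
  simp only [jetPoly, map_add, map_pow, aeval_X] at hjet
  have h2 := hjet 2 (by norm_num) (by norm_num)
  have h3 := hjet 3 (by norm_num) (by norm_num)
  have h4 := hjet 4 (by norm_num) (by norm_num)
  rw [e2] at h2
  rw [e3] at h3
  rw [e4] at h4
  set J := (jetIdeal k 2 (cuspIdeal k) 5).radical
  have hrad : J.IsRadical := Ideal.radical_isRadical _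
  have ha : X ((0 : Fin 2), (0 : Fin 5)) ∈ J := hrad ⟨2, h2⟩
  have hb : X ((1 : Fin 2), (0 : Fin 5)) ∈ J := by
    refine hrad ⟨3, ?_⟩
    rwa [J.add_mem_iff_right (J.mul_mem_right _ (J.mul_mem_left _ ha))] at h3
  have hc : X ((0 : Fin 2), (1 : Fin 5)) ∈ J := by
    refine hrad ⟨2, ?_⟩
    rwa [J.add_mem_iff_left (J.mul_mem_right _ (J.mul_mem_left _
      (J.pow_mem_of_mem hb 2 two_pos))),
      J.add_mem_iff_right (J.mul_mem_right _ (J.mul_mem_left _ ha))] at h4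
  rw [Ideal.span_le]
  rintro _ ⟨i, hi, rfl⟩
  rcases hi with rfl | rfl | rfl
  exacts [ha, hb, hc]

theorem jetIdeal_cusp_le :
    jetIdeal k 2 (cuspIdeal k) 5 ≤
      Ideal.span (X '' cuspVars : Set (MvPolynomial (Fin 2 × Fin 5) k)) := by
  rw [jetIdeal, Ideal.span_le]
  rintro _ ⟨f, hf, n, -, hn, rfl⟩
  obtain ⟨g, rfl⟩ := Ideal.mem_span_singleton.mp hf
  rw [SetLike.mem_coe, ← Ideal.Quotient.eq_zero_iff_mem, jetPoly, ← Polynomial.coeff_map]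
  have h (i) (hi : i ∈ cuspVars) : Ideal.Quotient.mk
      (Ideal.span (X '' cuspVars : Set (MvPolynomial (Fin 2 × Fin 5) k))) (X i) = 0 :=
    Ideal.Quotient.eq_zero_iff_mem.mpr (Ideal.subset_span ⟨i, hi, rfl⟩)
  have ha := h (0, 0) (by simp [cuspVars])
  have hb := h (1, 0) (by simp [cuspVars])
  have hc := h (0, 1) (by simp [cuspVars])
  refine Polynomial.X_pow_dvd_iff.mp ?_ n (Nat.lt_add_one_of_le hn)
  rw [map_mul, Polynomial.map_mul]
  apply dvd_mul_of_dvd_left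
  simpa [Polynomial.map_sum] using X_pow_six_dvd_aeval_cusp
    (fun i => Ideal.Quotient.mk _ (X ((0 : Fin 2), i)))
    (fun i => Ideal.Quotient.mk _ (X ((1 : Fin 2), i))) ha hc hb

theorem radical_jetIdeal_cusp :
    (jetIdeal k 2 (cuspIdeal k) 5).radical = Ideal.span (X '' cuspVars) :=
  le_antisymm ((isPrime_span_X_image cuspVars).radical_le_iff.mpr (jetIdeal_cusp_le k))
    (span_X_cuspVars_le_radical k)

theorem ringKrullDim_jet_cusp :
    ringKrullDim (MvPolynomial (Fin 2 × Fin 5) k ⧸ jetIdeal k 2 (cuspIdeal k) 5) = (7 : ℕ) := by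
  have hcard : Nat.card {i // i ∉ cuspVars} = 7 := by
    have : cuspVars = ({(0, 0), (1, 0), (0, 1)} : Finset (Fin 2 × Fin 5)) := by
      simp [cuspVars]
    simp only [this, Finset.mem_coe, Nat.card_eq_fintype_card]
    decide
  rw [← ringKrullDim_quotient_radical, radical_jetIdeal_cusp,
    ringKrullDim_quotient_span_X_image, hcard]

end Cusp

theorem cusp_not_top_singularity (k : Type*) [Field k] [IsAlgClosed k] [CharZero k] :
    (jetIdeal k 2 (cuspIdeal k) 5).radical =
      Ideal.span {(X ((0 : Fin 2), (0 : Fin 5)) : MvPolynomial (Fin 2 × Fin 5) k),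
        X ((1 : Fin 2), (0 : Fin 5)), X ((0 : Fin 2), (1 : Fin 5))} ∧
    ringKrullDim (MvPolynomial (Fin 2 × Fin 5) k ⧸ jetIdeal k 2 (cuspIdeal k) 5) = (7 : ℕ) ∧
    (7 : ℕ) > 5 * 1 + 1 ∧
    ¬ (∀ m : ℕ, 1 ≤ m →
        ringKrullDim (MvPolynomial (Fin 2 × Fin m) k ⧸ jetIdeal k 2 (cuspIdeal k) m)
          = (m * 1 + 1 : ℕ)) := by
  refine ⟨?_, ringKrullDim_jet_cusp k, by norm_num, fun h => ?_⟩
  · rw [radical_jetIdeal_cusp, cuspVars, Set.image_insert_eq, Set.image_pair]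
  · have h5 := (ringKrullDim_jet_cusp k).symm.trans (h 5 (by norm_num))
    norm_cast at h5
end

section
/- Every normal crossing double singularity (x₁x₂ = 0 in 𝔸^{d+1}) and every pinch point (x₁² − x₂²x₃ = 0 in 𝔸^{d+1}) is a top singularity, i.e. its Mather minimal log discrepancy with respect to the Jacobian ideal at the origin equals d − 1. -/
/-!
STATEMENT 10: Every normal crossing double singularity (`x₁x₂ = 0` in `𝔸^{d+1}`, `d ≥ 1`)
and every pinch point (`x₁² − x₂²x₃ = 0` in `𝔸^{d+1}`, `d ≥ 2`) is a top singularity, i.e.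
its Mather minimal log discrepancy w.r.t. the Jacobian ideal at the origin,
`m̂ld(0; X, 𝒥_X) = inf_m {(m+1)d − dim Xₘ⁰}`, equals `d − 1`.
(The infimum condition is spelled out as `dim Xₘ⁰ ≤ md+1` for all `m ≥ 1` with equality for
some `m ≥ 1`.)
-/

open MvPolynomial

/-- `m̂ld(0; V(I), 𝒥) = d − 1` via the jet-dimension formula. -/
def JetTop (k : Type*) [CommRing k] (N : ℕ) (I : Ideal (MvPolynomial (Fin N) k))
    (d : ℕ) : Prop :=
  (∀ m : ℕ, 1 ≤ m →
    ringKrullDim (MvPolynomial (Fin N × Fin m) k ⧸ jetIdeal k N I m) ≤ (m * d + 1 : ℕ)) ∧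
  (∃ m : ℕ, 1 ≤ m ∧
    ringKrullDim (MvPolynomial (Fin N × Fin m) k ⧸ jetIdeal k N I m) = (m * d + 1 : ℕ))

lemma ringKrullDim_le_of_isIntegral {A B : Type*} [CommRing A] [CommRing B]
    (g : A →+* B) (hg : g.IsIntegral) : ringKrullDim B ≤ ringKrullDim A := by
  let := g.toAlgebra
  refine Order.krullDim_le_of_strictMono (PrimeSpectrum.comap g) fun p q hpq => ?_
  obtain ⟨hle, x, hxq, hxp⟩ := SetLike.lt_iff_le_and_exists.mp
    (show p.asIdeal < q.asIdeal from hpq)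
  exact Ideal.comap_lt_comap_of_integral_mem_sdiff hle ⟨hxq, hxp⟩ (hg x)

lemma ringKrullDim_le_of_isAlgebraic_adjoin {k B : Type*} [Field k] [CommRing B] [IsDomain B]
    [Algebra k B] [Algebra.FiniteType k B] (s : Set B) [Finite s]
    [Algebra.IsAlgebraic (Algebra.adjoin k s) B] : ringKrullDim B ≤ Nat.card s := by
  obtain ⟨r, g, hinj, hint⟩ := exists_integral_inj_algHom_of_fg k B
  refine (ringKrullDim_le_of_isIntegral g.toRingHom hint).trans ?_
  have hX := (MvPolynomial.algebraicIndependent_X (Fin r) k).map' hinj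
  have h₁ := hX.lift_cardinalMk_le_trdeg.trans
    (Cardinal.lift_le.mpr (Algebra.IsAlgebraic.trdeg_le_cardinalMk k s))
  have hr : r ≤ Nat.card s := by
    have := Cardinal.toNat_le_toNat h₁ (by simp)
    simpa [Nat.card] using this
  simpa [Nat.card] using hr

lemma ringKrullDim_quotient_le_of_forall_isPrime {R : Type*} [CommRing R] (I : Ideal R) (n : ℕ)
    (h : ∀ P : Ideal R, P.IsPrime → I ≤ P → ringKrullDim (R ⧸ P) ≤ n) :
    ringKrullDim (R ⧸ I) ≤ n := by
  rw [ringKrullDim_quotient, Order.krullDim]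
  refine iSup_le fun l => ?_
  have hlen := WithBot.coe_le_coe.mpr (Order.length_le_coheight_head (p := l))
  refine hlen.trans ?_
  rw [Order.coheight_eq_krullDim_Ici]
  refine le_trans ?_ (h l.head.1.asIdeal l.head.1.isPrime l.head.2)
  rw [ringKrullDim_quotient]
  exact Order.krullDim_le_of_strictMono
    (fun x : Set.Ici l.head => (⟨x.1.1, x.2⟩ : PrimeSpectrum.zeroLocus
      (l.head.1.asIdeal : Set R))) fun _ _ hxy => hxy

lemma ringKrullDim_quotient_le_of_forall_subring {k σ : Type*} [Field k] [Fintype σ]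
    (P : Ideal (MvPolynomial σ k)) [P.IsPrime] (S : Finset σ)
    (h : ∀ L : Subring (MvPolynomial σ k ⧸ P), (∀ y z, y ≠ 0 → y ∈ L → y * z ∈ L → z ∈ L) →
      (∀ v ∈ S, Ideal.Quotient.mk P (X v) ∈ L) → ∀ v, Ideal.Quotient.mk P (X v) ∈ L) :
    ringKrullDim (MvPolynomial σ k ⧸ P) ≤ S.card := by
  set s : Set (MvPolynomial σ k ⧸ P) := (fun v => Ideal.Quotient.mk P (X v)) '' (S : Set σ)
  have hfin : s.Finite := S.finite_toSet.image _
  have := hfin.to_subtype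
  set A := Algebra.adjoin k s
  have hX : ∀ v, IsAlgebraic A (Ideal.Quotient.mk P (X v)) :=
    h (Subalgebra.algebraicClosure A _).toSubring
      (fun y z hy hyL hyz => IsAlgebraic.of_mul (mem_nonZeroDivisors_of_ne_zero hy) hyL hyz)
      (fun v hv => isAlgebraic_algebraMap (A := MvPolynomial σ k ⧸ P)
        (⟨_, Algebra.subset_adjoin ⟨v, hv, rfl⟩⟩ : A))
  have halg : Algebra.IsAlgebraic A (MvPolynomial σ k ⧸ P) := by
    refine ⟨fun x => ?_⟩
    obtain ⟨f, rfl⟩ := Ideal.Quotient.mk_surjective x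
    induction f using MvPolynomial.induction_on with
    | C a => exact isAlgebraic_algebraMap (A := MvPolynomial σ k ⧸ P) (algebraMap k A a)
    | add p q hp hq => exact map_add (Ideal.Quotient.mk P) p q ▸ hp.add hq
    | mul_X p v hp => exact map_mul (Ideal.Quotient.mk P) p (X v) ▸ hp.mul (hX v)
  refine (ringKrullDim_le_of_isAlgebraic_adjoin (k := k) s).trans ?_
  have hcard := Set.ncard_image_le (f := fun v => Ideal.Quotient.mk P (X v)) S.finite_toSet
  rw [Set.ncard_coe_finset] at hcard
  exact_mod_cast hcard

section PolynomialCoeff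

open Polynomial

lemma coeff_mul_mem {B : Type*} [CommRing B] {L : Subring B} {f g : B[X]} (hf : ∀ i, f.coeff i ∈ L)
    (hg : ∀ i, g.coeff i ∈ L) (i : ℕ) : (f * g).coeff i ∈ L := by
  rw [Polynomial.coeff_mul]
  exact sum_mem fun _ _ => mul_mem (hf _) (hg _)

/-- If `w * c` and `f` agree up to order `r`, then the first `r` coefficients of `c` are rational
in the coefficients of `w` and `f`. -/
lemma coeff_mem_of_X_pow_dvd {B : Type*} [CommRing B] {L : Subring B}
    (hL : ∀ y z, y ≠ 0 → y ∈ L → y * z ∈ L → z ∈ L)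
    {w f c : B[X]} {r : ℕ} (hw₀ : w.coeff 0 ≠ 0) (hw : ∀ i, w.coeff i ∈ L)
    (hf : ∀ i, f.coeff i ∈ L) (h : Polynomial.X ^ r ∣ f - w * c)
    (hc : ∀ i, r ≤ i → c.coeff i ∈ L) (i : ℕ) : c.coeff i ∈ L := by
  induction i using Nat.strong_induction_on with
  | _ i ih =>
    rcases le_or_gt r i with hri | hir
    · exact hc i hri
    · have h₀ := Polynomial.X_pow_dvd_iff.mp h i hir
      rw [Polynomial.coeff_sub, sub_eq_zero, Polynomial.coeff_mul,
        Finset.Nat.sum_antidiagonal_eq_sum_range_succ (fun a b => w.coeff a * c.coeff b),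
        Finset.sum_range_succ', Nat.sub_zero] at h₀
      refine hL _ _ hw₀ (hw 0) ?_
      rw [← sub_eq_iff_eq_add'.mpr h₀]
      refine sub_mem (hf i) (sum_mem fun j hj => mul_mem (hw _) (ih _ ?_))
      have := Finset.mem_range.mp hj
      omega

variable {B : Type*} [CommRing B] [IsDomain B]

lemma exists_X_pow_dvd_of_dvd_mul {n : ℕ} {a b : B[X]} (h : Polynomial.X ^ n ∣ a * b) :
    ∃ p q, p + q = n ∧ Polynomial.X ^ p ∣ a ∧ Polynomial.X ^ q ∣ b := by
  obtain ⟨c, hc⟩ := h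
  obtain ⟨i, j, u, v, hij, -, rfl, rfl⟩ :=
    mul_eq_mul_prime_pow Polynomial.prime_X (hc.trans (mul_comm _ _))
  exact ⟨i, j, hij, dvd_mul_left _ _, dvd_mul_left _ _⟩

lemma X_pow_dvd_of_dvd_sq {n p : ℕ} {a : B[X]} (h : Polynomial.X ^ n ∣ a ^ 2)
    (hp : 2 * p ≤ n + 1) : Polynomial.X ^ p ∣ a := by
  obtain ⟨i, j, hij, hi, hj⟩ := exists_X_pow_dvd_of_dvd_mul (sq a ▸ h)
  rcases le_total i j with hle | hle
  · exact (pow_dvd_pow _ (by omega)).trans hj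
  · exact (pow_dvd_pow _ (by omega)).trans hi

lemma exists_orders_of_X_pow_dvd_pinch {n : ℕ} {a b c : B[X]}
    (h : Polynomial.X ^ n ∣ a ^ 2 - Polynomial.X * b ^ 2 * c) :
    ∃ p q r, p + q + r = n ∧ Polynomial.X ^ p ∣ a ∧ Polynomial.X ^ q ∣ b ∧
      ∀ L : Subring B, (∀ y z, y ≠ 0 → y ∈ L → y * z ∈ L → z ∈ L) →
        (∀ i, a.coeff i ∈ L) → (∀ i, b.coeff i ∈ L) → (∀ i, r ≤ i → c.coeff i ∈ L) →
        ∀ i, c.coeff i ∈ L := by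
  by_cases hb : Polynomial.X ^ (n / 2) ∣ b
  · refine ⟨n - n / 2, n / 2, 0, by omega, ?_, hb, fun L _ _ _ hc i => hc i (Nat.zero_le i)⟩
    refine X_pow_dvd_of_dvd_sq (n := n) ?_ (by omega)
    refine (dvd_sub_left (c := Polynomial.X * b ^ 2 * c) ?_).mp h
    obtain ⟨u, rfl⟩ := hb
    refine (pow_dvd_pow _ (show n ≤ 1 + n / 2 * 2 by omega)).trans ⟨u ^ 2 * c, by ring⟩
  · have hex : ∃ q, b.coeff q ≠ 0 := by
      by_contra! h₀
      exact hb (Polynomial.X_pow_dvd_iff.mpr fun d _ => h₀ d)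
    classical
    set q := Nat.find hex
    have hq : b.coeff q ≠ 0 := Nat.find_spec hex
    have hqn : q < n / 2 := by
      by_contra! hle
      exact hb (Polynomial.X_pow_dvd_iff.mpr fun d hd =>
        not_not.mp (Nat.find_min hex (hd.trans_le hle)))
    obtain ⟨u, hu⟩ : Polynomial.X ^ q ∣ b :=
      Polynomial.X_pow_dvd_iff.mpr fun d hd => not_not.mp (Nat.find_min hex hd)
    have hu_coeff (i : ℕ) : u.coeff i = b.coeff (i + q) := by
      rw [hu, Polynomial.coeff_X_pow_mul]
    have ha : Polynomial.X ^ (q + 1) ∣ a := by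
      refine X_pow_dvd_of_dvd_sq (n := 2 * q + 1) ?_ (by omega)
      refine (dvd_sub_left (c := Polynomial.X * b ^ 2 * c) ?_).mp
        ((pow_dvd_pow _ (by omega)).trans h)
      exact ⟨u ^ 2 * c, by rw [hu]; ring⟩
    obtain ⟨v, hv⟩ := ha
    have hv_coeff (i : ℕ) : v.coeff i = a.coeff (i + (q + 1)) := by
      rw [hv, Polynomial.coeff_X_pow_mul]
    refine ⟨q + 1, q, n - (2 * q + 1), by omega, ⟨v, hv⟩, ⟨u, hu⟩, fun L hL hal hbl hcl => ?_⟩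
    have hul (i : ℕ) : u.coeff i ∈ L := hu_coeff i ▸ hbl _
    have hvl (i : ℕ) : v.coeff i ∈ L := hv_coeff i ▸ hal _
    have hXl (i : ℕ) : (Polynomial.X : B[X]).coeff i ∈ L := by
      rw [Polynomial.coeff_X]; split_ifs <;> [exact one_mem _; exact zero_mem _]
    refine coeff_mem_of_X_pow_dvd hL (w := u ^ 2) (f := Polynomial.X * v ^ 2) ?_ ?_ ?_ ?_ hcl
    · rw [Polynomial.coeff_zero_eq_eval_zero, Polynomial.eval_pow,
        ← Polynomial.coeff_zero_eq_eval_zero, hu_coeff, zero_add]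
      exact pow_ne_zero _ hq
    · exact sq u ▸ coeff_mul_mem hul hul
    · exact coeff_mul_mem hXl (sq v ▸ coeff_mul_mem hvl hvl)
    · refine (mul_dvd_mul_iff_left (pow_ne_zero (2 * q + 1) Polynomial.X_ne_zero)).mp ?_
      rw [← pow_add, Nat.add_sub_cancel' (by omega)]
      refine h.trans (dvd_of_eq ?_)
      rw [hv, hu]; ring

end PolynomialCoeff

lemma ringKrullDim_quotient_jetIdeal_le {k : Type*} [Field k] {N m D : ℕ}
    {I : Ideal (MvPolynomial (Fin N) k)}
    (h : ∀ P : Ideal (MvPolynomial (Fin N × Fin m) k), P.IsPrime → jetIdeal k N I m ≤ P →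
      ∃ e : Fin N → ℕ, (∀ j, e j ≤ m) ∧ N * m ≤ D + ∑ j, e j ∧
        ∀ L : Subring (MvPolynomial (Fin N × Fin m) k ⧸ P),
          (∀ y z, y ≠ 0 → y ∈ L → y * z ∈ L → z ∈ L) →
          (∀ v : Fin N × Fin m, e v.1 ≤ v.2 → Ideal.Quotient.mk P (X v) ∈ L) →
          ∀ v, Ideal.Quotient.mk P (X v) ∈ L) :
    ringKrullDim (MvPolynomial (Fin N × Fin m) k ⧸ jetIdeal k N I m) ≤ D := by
  refine ringKrullDim_quotient_le_of_forall_isPrime _ _ fun P hP hIP => ?_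
  obtain ⟨e, hem, hcard, hL⟩ := h P hP hIP
  refine (ringKrullDim_quotient_le_of_forall_subring P
    (Finset.univ.filter fun v : Fin N × Fin m => ¬ (v.2 : ℕ) < e v.1)
    fun L hdiv hmem => hL L hdiv fun v hv => hmem v (by simpa using hv)).trans ?_
  have hlt : (Finset.univ.filter fun v : Fin N × Fin m => (v.2 : ℕ) < e v.1).card
      = ∑ j, e j := by
    rw [Finset.card_filter, Fintype.sum_prod_type]
    refine Finset.sum_congr rfl fun j _ => ?_
    rw [← Finset.card_filter]
    exact Fin.card_filter_val_lt.trans (min_eq_right (hem j))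
  have htot := Finset.card_filter_add_card_filter_not (s := Finset.univ)
    (fun v : Fin N × Fin m => (v.2 : ℕ) < e v.1)
  rw [hlt, Finset.card_univ, Fintype.card_prod, Fintype.card_fin, Fintype.card_fin] at htot
  exact_mod_cast (show _ ≤ D by omega)

/-- The `j`-th coordinate, divided by `t`, of the `m`-jet at the origin with coefficients `x`. -/
noncomputable def jetCoord {B : Type*} [CommRing B] {N m : ℕ} (x : Fin N × Fin m → B)
    (j : Fin N) : Polynomial B :=
  ∑ i : Fin m, Polynomial.C (x (j, i)) * Polynomial.X ^ (i : ℕ)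

section JetCoord

variable {B : Type*} [CommRing B] {N m : ℕ}

lemma coeff_jetCoord (x : Fin N × Fin m → B) (j : Fin N) (n : ℕ) :
    (jetCoord x j).coeff n = if h : n < m then x (j, ⟨n, h⟩) else 0 := by
  simp only [jetCoord, Polynomial.finsetSum_coeff, Polynomial.coeff_C_mul, Polynomial.coeff_X_pow]
  split_ifs with h
  · rw [Finset.sum_eq_single ⟨n, h⟩] <;> simp +contextual [Fin.ext_iff, eq_comm]
  · exact Finset.sum_eq_zero fun i _ => by rw [if_neg (by omega), mul_zero]

lemma coeff_jetCoord_val (x : Fin N × Fin m → B) (j : Fin N) (i : Fin m) :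
    (jetCoord x j).coeff i = x (j, i) := by
  rw [coeff_jetCoord, dif_pos i.isLt]

lemma coeff_jetCoord_mem (x : Fin N × Fin m → B) {j : Fin N} {e : ℕ}
    (he : Polynomial.X ^ e ∣ jetCoord x j) {L : Subring B}
    (hL : ∀ i : Fin m, e ≤ i → x (j, i) ∈ L) (n : ℕ) : (jetCoord x j).coeff n ∈ L := by
  rcases lt_or_ge n e with hn | hn
  · exact Polynomial.X_pow_dvd_iff.mp he n hn ▸ zero_mem L
  · rw [coeff_jetCoord]
    split_ifs with h
    exacts [hL ⟨n, h⟩ hn, zero_mem L]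

variable {k : Type*} [CommRing k] [Algebra k B]

lemma coeff_aeval_jetCoord (φ : MvPolynomial (Fin N × Fin m) k →ₐ[k] B)
    (f : MvPolynomial (Fin N) k) (n : ℕ) :
    (aeval (fun j => Polynomial.X * jetCoord (fun v => φ (X v)) j) f).coeff n
      = φ (jetPoly k N m f n) := by
  have h : aeval (fun j => Polynomial.X * jetCoord (fun v => φ (X v)) j) =
      (Polynomial.mapAlgHom φ).comp (aeval (fun j : Fin N => ∑ i : Fin m,
          Polynomial.C (MvPolynomial.X (R := k) (j, i)) * Polynomial.X ^ ((i : ℕ) + 1))) := by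
    ext1 j
    simp [jetCoord, Finset.mul_sum, Polynomial.map_sum, pow_succ', mul_left_comm]
  rw [h, jetPoly]
  simp [Polynomial.coeff_map]

lemma X_pow_dvd_aeval_jetCoord (φ : MvPolynomial (Fin N × Fin m) k →ₐ[k] B)
    {I : Ideal (MvPolynomial (Fin N) k)} (hφ : ∀ g ∈ jetIdeal k N I m, φ g = 0)
    {f : MvPolynomial (Fin N) k} (hf : f ∈ I)
    (hf₀ : (aeval (fun j => Polynomial.X * jetCoord (fun v => φ (X v)) j) f).coeff 0 = 0) :
    Polynomial.X ^ (m + 1) ∣ aeval (fun j => Polynomial.X * jetCoord (fun v => φ (X v)) j) f := by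
  refine Polynomial.X_pow_dvd_iff.mpr fun n hn => ?_
  rcases Nat.eq_zero_or_pos n with rfl | hpos
  · exact hf₀
  · rw [coeff_aeval_jetCoord]
    exact hφ _ (Ideal.subset_span ⟨f, hf, n, hpos, by omega, rfl⟩)

end JetCoord

lemma jetIdeal_one_eq_bot {k : Type*} [CommRing k] {N : ℕ} {f : MvPolynomial (Fin N) k}
    (hf : ∀ a : Fin N → Polynomial (MvPolynomial (Fin N × Fin 1) k),
      Polynomial.X ^ 2 ∣ aeval (fun j => Polynomial.X * a j) f) :
    jetIdeal k N (Ideal.span {f}) 1 = ⊥ := by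
  rw [jetIdeal, Ideal.span_eq_bot]
  rintro _ ⟨g, hg, n, hn₁, hn, rfl⟩
  obtain ⟨c, rfl⟩ := Ideal.mem_span_singleton.mp hg
  have h := coeff_aeval_jetCoord (AlgHom.id k (MvPolynomial (Fin N × Fin 1) k)) (f * c) n
  rw [AlgHom.id_apply] at h
  rw [← h, map_mul]
  exact Polynomial.X_pow_dvd_iff.mp ((hf _).mul_right _) n (by omega)

lemma ringKrullDim_quotient_jetIdeal_one {k : Type*} [Field k] {d : ℕ}
    {f : MvPolynomial (Fin (d + 1)) k}
    (hf : ∀ a : Fin (d + 1) → Polynomial (MvPolynomial (Fin (d + 1) × Fin 1) k),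
      Polynomial.X ^ 2 ∣ aeval (fun j => Polynomial.X * a j) f) :
    ringKrullDim (MvPolynomial (Fin (d + 1) × Fin 1) k ⧸ jetIdeal k (d + 1) (Ideal.span {f}) 1)
      = (1 * d + 1 : ℕ) := by
  rw [jetIdeal_one_eq_bot hf, ringKrullDim_eq_of_ringEquiv (RingEquiv.quotientBot _)]
  simp

lemma jetTop_mul {k : Type*} [Field k] {d : ℕ} (hd : 1 ≤ d) :
    JetTop k (d + 1) (Ideal.span {(X 0 * X 1 : MvPolynomial (Fin (d + 1)) k)}) d := by
  have h01 : (0 : Fin (d + 1)) ≠ 1 := by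
    simp [Fin.ext_iff, Nat.mod_eq_of_lt (show 1 < d + 1 by omega)]
  refine ⟨fun m hm => ringKrullDim_quotient_jetIdeal_le fun P hP hIP => ?_,
    1, le_rfl, ringKrullDim_quotient_jetIdeal_one fun a => ⟨a 0 * a 1, by simp; ring⟩⟩
  set φ := Ideal.Quotient.mkₐ k P
  have hdvd := X_pow_dvd_aeval_jetCoord φ
    (fun g hg => Ideal.Quotient.eq_zero_iff_mem.mpr (hIP hg)) (Ideal.mem_span_singleton_self _)
    (by simp)
  obtain ⟨n, rfl⟩ : ∃ n, m = n + 1 := ⟨m - 1, by omega⟩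
  set a := jetCoord (fun v => φ (X v))
  have hab : Polynomial.X ^ n ∣ a 0 * a 1 := by
    refine (mul_dvd_mul_iff_left (pow_ne_zero 2 Polynomial.X_ne_zero)).mp ?_
    convert! hdvd using 1
    · ring
    · simp; ring
  obtain ⟨p, q, hpq, hp, hq⟩ := exists_X_pow_dvd_of_dvd_mul hab
  refine ⟨Pi.single 0 p + Pi.single 1 q, fun j => ?_, ?_, fun L _ hmem => ?_⟩
  · simp only [Pi.add_apply, Pi.single_apply]
    split_ifs <;> omega
  · simp only [Pi.add_apply, Finset.sum_add_distrib, Finset.sum_pi_single', Finset.mem_univ,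
      if_true]
    nlinarith
  · have hcoeff (j : Fin (d + 1)) (i : ℕ) : (a j).coeff i ∈ L := by
      by_cases h0 : j = 0
      · subst h0
        exact coeff_jetCoord_mem _ hp (fun i hi => hmem (0, i) (by simpa [h01] using hi)) _
      by_cases h1 : j = 1
      · subst h1
        exact coeff_jetCoord_mem _ hq (fun i hi => hmem (1, i) (by simpa [h01.symm] using hi)) _
      · refine coeff_jetCoord_mem _ (e := 0) (by simp) (fun i _ => hmem (j, i) ?_) _
        simp [h0, h1]
    rintro ⟨j, i⟩
    exact coeff_jetCoord_val (fun v => φ (X v)) j i ▸ hcoeff j i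

lemma jetTop_pinch {k : Type*} [Field k] {d : ℕ} (hd : 2 ≤ d) :
    JetTop k (d + 1) (Ideal.span
      {(X (0 : Fin (d + 1)) ^ 2 - X (1 : Fin (d + 1)) ^ 2 * X (2 : Fin (d + 1)) :
        MvPolynomial (Fin (d + 1)) k)}) d := by
  obtain ⟨d, rfl⟩ : ∃ d', d = d' + 2 := ⟨d - 2, by omega⟩
  have h01 : (0 : Fin (d + 2 + 1)) ≠ 1 := by simp
  have h02 : (0 : Fin (d + 2 + 1)) ≠ 2 := by
    simp [Fin.ext_iff, Nat.mod_eq_of_lt (show 2 < d + 2 + 1 by omega)]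
  have h12 : (1 : Fin (d + 2 + 1)) ≠ 2 := by
    simp [Fin.ext_iff, Nat.mod_eq_of_lt (show 2 < d + 2 + 1 by omega)]
  refine ⟨fun m hm => ringKrullDim_quotient_jetIdeal_le fun P hP hIP => ?_,
    1, le_rfl, ringKrullDim_quotient_jetIdeal_one fun a =>
      ⟨a 0 ^ 2 - Polynomial.X * a 1 ^ 2 * a 2, by simp; ring⟩⟩
  set φ := Ideal.Quotient.mkₐ k P
  have hdvd := X_pow_dvd_aeval_jetCoord φ
    (fun g hg => Ideal.Quotient.eq_zero_iff_mem.mpr (hIP hg)) (Ideal.mem_span_singleton_self _)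
    (by simp [mul_pow, Polynomial.coeff_zero_eq_eval_zero])
  obtain ⟨n, rfl⟩ : ∃ n, m = n + 1 := ⟨m - 1, by omega⟩
  set a := jetCoord (fun v => φ (X v))
  have habc : Polynomial.X ^ n ∣ a 0 ^ 2 - Polynomial.X * a 1 ^ 2 * a 2 := by
    refine (mul_dvd_mul_iff_left (pow_ne_zero 2 Polynomial.X_ne_zero)).mp ?_
    convert! hdvd using 1
    · ring
    · simp; ring
  obtain ⟨p, q, r, hpqr, hp, hq, hr⟩ := exists_orders_of_X_pow_dvd_pinch habc
  refine ⟨Pi.single 0 p + Pi.single 1 q + Pi.single 2 r, fun j => ?_, ?_, fun L hL hmem => ?_⟩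
  · simp only [Pi.add_apply, Pi.single_apply]
    split_ifs <;> omega
  · simp only [Pi.add_apply, Finset.sum_add_distrib, Finset.sum_pi_single', Finset.mem_univ,
      if_true]
    nlinarith
  · have h0 := coeff_jetCoord_mem _ hp (L := L) fun i hi =>
      hmem (0, i) (by simpa [h01, h02] using hi)
    have h1 := coeff_jetCoord_mem _ hq (L := L) fun i hi =>
      hmem (1, i) (by simpa [h01.symm, h12] using hi)
    have h2 : ∀ i, (a 2).coeff i ∈ L := by
      refine hr L hL h0 h1 fun i hi => ?_
      rw [coeff_jetCoord]
      split_ifs with him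
      · exact hmem (2, ⟨i, him⟩) (by simpa [h02.symm, h12.symm] using hi)
      · exact zero_mem L
    have hcoeff (j : Fin (d + 2 + 1)) (i : ℕ) : (a j).coeff i ∈ L := by
      by_cases hj0 : j = 0
      · exact hj0 ▸ h0 i
      by_cases hj1 : j = 1
      · exact hj1 ▸ h1 i
      by_cases hj2 : j = 2
      · exact hj2 ▸ h2 i
      refine coeff_jetCoord_mem _ (e := 0) (by simp) (fun i _ => hmem (j, i) ?_) _
      simp [hj0, hj1, hj2]
    rintro ⟨j, i⟩
    exact coeff_jetCoord_val (fun v => φ (X v)) j i ▸ hcoeff j i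

theorem ncd_and_pinch_are_top (k : Type*) [Field k] [IsAlgClosed k] [CharZero k] :
    (∀ d : ℕ, 1 ≤ d →
      JetTop k (d + 1)
        (Ideal.span {(X 0 * X 1 : MvPolynomial (Fin (d + 1)) k)}) d) ∧
    (∀ d : ℕ, 2 ≤ d →
      JetTop k (d + 1)
        (Ideal.span
          {(X (0 : Fin (d + 1)) ^ 2 - X (1 : Fin (d + 1)) ^ 2 * X (2 : Fin (d + 1)) :
            MvPolynomial (Fin (d + 1)) k)}) d) := by
  exact ⟨fun _ => jetTop_mul, fun _ => jetTop_pinch⟩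
end
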